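/- Bilinear estimate for families of functions (Corollary 2.8). Let α₁, α₂, β₁, β₂ ∈ ℝ∖{0} and γ₁, γ₂ ∈ ℝ satisfy γ_j ≤ min(α_j, β_j) and α_j + β_j > 0 for j = 1, 2. Then there is a constant C, depending only on the exponents, such that for all families (F_M) and (G_M) of C_b^∞ functions ℝ² → ℝ indexed by dyadic scales M, with the property that P_N^u G_M = 0 for all dyadic N with N ≁ M, and for every finite set S of dyadic scales, one has ‖Σ_{M∈S} F_M · G_M‖_{C_u^{γ₁}C_v^{γ₂}} ≤ C (sup_M ‖F_M‖_{C_u^{α₁}C_v^{α₂}}) (sup_M ‖G_M‖_{C_u^{β₁}C_v^{β₂}}). -/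

import Mathlib

noncomputable section

open Real MeasureTheory
open scoped ENNReal Classical NNReal

/-- A function between real normed spaces is `C_b^∞`: it is smooth and it together with all of
its iterated derivatives is bounded. -/
def CbSmooth {E F : Type*} [NormedAddCommGroup E] [NormedSpace ℝ E]
    [NormedAddCommGroup F] [NormedSpace ℝ F] (f : E → F) : Prop :=
  ContDiff ℝ (⊤ : ℕ∞) f ∧ ∀ n : ℕ, ∃ C : ℝ, ∀ x : E, ‖iteratedFDeriv ℝ n f x‖ ≤ C

/-- An admissible Littlewood–Paley cutoff: a smooth even `[0,1]`-valued function which is `≡ 1`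
on `{|ξ| ≤ 7/8}` and vanishes on `{|ξ| ≥ 9/8}`. -/
structure IsLPCutoff (ρ : ℝ → ℝ) : Prop where
  smooth : ContDiff ℝ (⊤ : ℕ∞) ρ
  nonneg : ∀ ξ, 0 ≤ ρ ξ
  le_one : ∀ ξ, ρ ξ ≤ 1
  even : ∀ ξ, ρ (-ξ) = ρ ξ
  eq_one : ∀ ξ : ℝ, |ξ| ≤ 7 / 8 → ρ ξ = 1
  eq_zero : ∀ ξ : ℝ, 9 / 8 ≤ |ξ| → ρ ξ = 0

/-- The Littlewood–Paley symbol `ρ_N` at the dyadic scale `N = 2 ^ k`. -/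
def lpSymbol (ρ : ℝ → ℝ) : ℕ → ℝ → ℝ
  | 0 => ρ
  | k + 1 => fun ξ => ρ (ξ / 2 ^ (k + 1)) - ρ (2 * ξ / 2 ^ (k + 1))

/-- The inverse Fourier transform `(2π)^{-1/2} ∫ e^{ixξ} g(ξ) dξ` of a real even function,
written as a cosine transform. -/
def invFourier (g : ℝ → ℝ) (x : ℝ) : ℝ :=
  (Real.sqrt (2 * Real.pi))⁻¹ * ∫ ξ : ℝ, Real.cos (x * ξ) * g ξ

/-- The Littlewood–Paley convolution kernel `ρ̌_N`, `N = 2 ^ k`. -/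
def lpKernel (ρ : ℝ → ℝ) (k : ℕ) : ℝ → ℝ :=
  invFourier (lpSymbol ρ k)

/-- The Littlewood–Paley projection `P_N f = ρ̌_N ∗ f`, `N = 2 ^ k`. -/
def LP (ρ : ℝ → ℝ) (k : ℕ) (f : ℝ → ℝ) (x : ℝ) : ℝ :=
  ∫ y : ℝ, lpKernel ρ k y * f (x - y)

/-- The Littlewood–Paley projection in the first variable. -/
def LPu (ρ : ℝ → ℝ) (k : ℕ) (F : ℝ × ℝ → ℝ) (p : ℝ × ℝ) : ℝ :=
  ∫ y : ℝ, lpKernel ρ k y * F (p.1 - y, p.2)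

/-- The Littlewood–Paley projection in the second variable. -/
def LPv (ρ : ℝ → ℝ) (k : ℕ) (F : ℝ × ℝ → ℝ) (p : ℝ × ℝ) : ℝ :=
  ∫ y : ℝ, lpKernel ρ k y * F (p.1, p.2 - y)

/-- The Hölder norm `‖f‖_{C^γ} = sup_N N^γ ‖P_N f‖_{L^∞}`, valued in `[0,∞]`. -/
def hNorm (ρ : ℝ → ℝ) (γ : ℝ) (f : ℝ → ℝ) : ℝ≥0∞ :=
  ⨆ k : ℕ, ENNReal.ofReal (((2 : ℝ) ^ k) ^ γ) * ⨆ x : ℝ, ENNReal.ofReal |LP ρ k f x|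

/-- The product Hölder norm `‖F‖_{C_u^{γ₁} C_v^{γ₂}}`, valued in `[0,∞]`. -/
def hNorm2 (ρ : ℝ → ℝ) (γ₁ γ₂ : ℝ) (F : ℝ × ℝ → ℝ) : ℝ≥0∞ :=
  ⨆ k₁ : ℕ, ⨆ k₂ : ℕ,
    ENNReal.ofReal (((2 : ℝ) ^ k₁) ^ γ₁ * ((2 : ℝ) ^ k₂) ^ γ₂) *
      ⨆ p : ℝ × ℝ, ENNReal.ofReal |LPu ρ k₁ (LPv ρ k₂ F) p|

/-- `2 ^ k₁ ∼ 2 ^ k₂`: comparable dyadic scales. -/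
def DClose (k₁ k₂ : ℕ) : Prop :=
  (2 : ℝ) ^ k₂ / 2 ^ 10 < (2 : ℝ) ^ k₁ ∧ (2 : ℝ) ^ k₁ < 2 ^ 10 * (2 : ℝ) ^ k₂

/-- `2 ^ k₁ ≪ 2 ^ k₂`. -/
def DLow (k₁ k₂ : ℕ) : Prop := (2 : ℝ) ^ k₁ ≤ (2 : ℝ) ^ k₂ / 2 ^ 10

/-- `2 ^ k₁ ≳ 2 ^ k₂`. -/
def DGtr (k₁ k₂ : ℕ) : Prop := (2 : ℝ) ^ k₂ ≤ 2 ^ 10 * (2 : ℝ) ^ k₁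

section fourierfacts
open scoped FourierTransform

lemma rho_cs {ρ : ℝ → ℝ} (hρ : IsLPCutoff ρ) : HasCompactSupport ρ := by
  refine HasCompactSupport.intro (isCompact_Icc (a := (-(9/8) : ℝ)) (b := 9/8)) ?_
  intro x hx
  apply hρ.eq_zero
  by_contra h
  push Not at h
  exact hx (abs_le.1 h.le)

lemma rho_integrable {ρ : ℝ → ℝ} (hρ : IsLPCutoff ρ) : Integrable ρ :=
  hρ.smooth.continuous.integrable_of_hasCompactSupport (rho_cs hρ)

lemma fourier_rho {ρ : ℝ → ℝ} (hρ : IsLPCutoff ρ) (w : ℝ) :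
    𝓕 (fun x => (ρ x : ℂ)) w = ((Real.sqrt (2 * π) * invFourier ρ (2 * π * w) : ℝ) : ℂ) := by
  have hs : Real.sqrt (2 * π) ≠ 0 := by positivity
  have h1 : ∀ w : ℝ, 𝓕 (fun x => (ρ x : ℂ)) w
      = ∫ x : ℝ, (((Real.cos (2 * π * w * x) * ρ x : ℝ) : ℂ)
        - Complex.I * ((Real.sin (2 * π * w * x) * ρ x : ℝ) : ℂ)) := by
    intro w
    rw [Real.fourier_real_eq_integral_exp_smul]
    congr 1
    ext x
    have : ((-2 * π * x * w : ℝ) : ℂ) * Complex.I = ((-(2 * π * w * x) : ℝ) : ℂ) * Complex.I := by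
      congr 2; ring
    rw [this, Complex.exp_mul_I, ← Complex.ofReal_cos, ← Complex.ofReal_sin, Real.cos_neg,
      Real.sin_neg]
    push_cast
    simp only [smul_eq_mul]
    ring
  have hi1 : Integrable (fun x => Real.cos (2 * π * w * x) * ρ x) :=
    (rho_integrable hρ).bdd_mul (c := 1) (by fun_prop) (by
      filter_upwards with x; exact Real.abs_cos_le_one _)
  have hi2 : Integrable (fun x => Real.sin (2 * π * w * x) * ρ x) :=
    (rho_integrable hρ).bdd_mul (c := 1) (by fun_prop) (by
      filter_upwards with x; exact Real.abs_sin_le_one _)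
  have h2 : ∫ x : ℝ, Real.sin (2 * π * w * x) * ρ x = 0 := by
    have := integral_neg_eq_self (fun x => Real.sin (2 * π * w * x) * ρ x) volume
    simp only [mul_neg, Real.sin_neg, hρ.even, neg_mul, integral_neg] at this
    linarith
  rw [h1, integral_sub hi1.ofReal (hi2.ofReal.const_mul _), integral_const_mul,
    integral_complex_ofReal, integral_complex_ofReal, h2]
  simp only [invFourier]
  rw [mul_inv_cancel_left₀ hs]
  simp

lemma kap_fourier {ρ : ℝ → ℝ} (hρ : IsLPCutoff ρ) :
    Continuous (invFourier ρ) ∧ Integrable (invFourier ρ) ∧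
    ∀ ξ, ∫ z, invFourier ρ z * Real.cos (z * ξ) = Real.sqrt (2 * π) * ρ ξ := by
  have hs : Real.sqrt (2 * π) ≠ 0 := by positivity
  have hp : (2 * π) ≠ 0 := by positivity
  let f : ℝ → ℂ := fun x => (ρ x : ℂ)
  have hcs : HasCompactSupport f := (rho_cs hρ).comp_left (g := fun x : ℝ => (x : ℂ)) (by simp)
  have hsm : ContDiff ℝ (⊤ : ℕ∞) f := Complex.ofRealCLM.contDiff.comp hρ.smooth
  let Φ : SchwartzMap ℝ ℂ := hcs.toSchwartzMap hsm
  have hΦ : (Φ : ℝ → ℂ) = f := rfl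
  have hF : ((𝓕 Φ : SchwartzMap ℝ ℂ) : ℝ → ℂ) = 𝓕 f := by
    rw [SchwartzMap.fourier_coe, hΦ]
  have hFi : Integrable (𝓕 f) := hF ▸ (𝓕 Φ).integrable
  have hFc : Continuous (𝓕 f) := hF ▸ (𝓕 Φ).continuous
  have hk : ∀ x, invFourier ρ x = (Real.sqrt (2 * π))⁻¹ * (𝓕 f ((2 * π)⁻¹ * x)).re := by
    intro x
    rw [fourier_rho hρ, Complex.ofReal_re, mul_inv_cancel_left₀ hp, inv_mul_cancel_left₀ hs]
  have hk' : invFourier ρ = fun x => (Real.sqrt (2 * π))⁻¹ * (𝓕 f ((2 * π)⁻¹ * x)).re :=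
    funext hk
  have hki : Integrable (invFourier ρ) := by
    rw [hk']
    refine Integrable.const_mul ?_ _
    exact Integrable.comp_mul_left' (g := fun x => (𝓕 f x).re) hFi.re (inv_ne_zero hp)
  refine ⟨?_, hki, ?_⟩
  · rw [hk']; fun_prop
  · intro ξ
    have hinv := congrFun (hsm.continuous.fourierInv_fourier_eq
      (hsm.continuous.integrable_of_hasCompactSupport hcs) hFi) ξ
    rw [Real.fourierInv_eq'] at hinv
    have hre := congrArg Complex.re hinv
    have h_intgr : Integrable (fun v : ℝ => Complex.exp (((2 * π * inner ℝ v ξ : ℝ) : ℂ) * Complex.I) • 𝓕 f v) := by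
      refine hFi.bdd_mul (c := 1) (f := fun v : ℝ => Complex.exp (((2 * π * inner ℝ v ξ : ℝ) : ℂ) * Complex.I))
        (Continuous.aestronglyMeasurable (by fun_prop)) ?_
      filter_upwards with v
      rw [Complex.norm_exp_ofReal_mul_I]
    have h3 := integral_re (𝕜 := ℂ) h_intgr
    simp only [RCLike.re_to_complex] at h3
    rw [← h3] at hre
    have h4 : ∀ v : ℝ, (Complex.exp (((2 * π * inner ℝ v ξ : ℝ) : ℂ) * Complex.I) • 𝓕 f v).re
       = Real.sqrt (2 * π) * (fun z => invFourier ρ z * Real.cos (z * ξ)) (2 * π * v) := by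
      intro v
      rw [fourier_rho hρ, Complex.exp_mul_I, ← Complex.ofReal_cos, ← Complex.ofReal_sin]
      have : 2 * π * inner ℝ v ξ = 2 * π * v * ξ := by simp; ring
      rw [this, smul_eq_mul, Complex.re_mul_ofReal, Complex.add_re, Complex.ofReal_re,
        Complex.mul_I_re, Complex.ofReal_im]
      ring
    simp_rw [h4] at hre
    rw [integral_const_mul,
      Measure.integral_comp_mul_left (fun z => invFourier ρ z * Real.cos (z * ξ))] at hre
    rw [abs_of_pos (by positivity : (0:ℝ) < (2 * π)⁻¹)] at hre
    have h5 : (f ξ).re = ρ ξ := Complex.ofReal_re _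
    rw [h5] at hre
    rw [← hre, smul_eq_mul, ← mul_assoc, ← mul_assoc, Real.mul_self_sqrt (by positivity),
      mul_inv_cancel₀ hp, one_mul]

end fourierfacts

def kapk (ρ : ℝ → ℝ) (k : ℕ) (x : ℝ) : ℝ := 2 ^ k * invFourier ρ (2 ^ k * x)

lemma invFourier_scale (ρ : ℝ → ℝ) (k : ℕ) (x : ℝ) :
    invFourier (fun ξ => ρ (ξ / 2 ^ k)) x = kapk ρ k x := by
  have hk : (0 : ℝ) < 2 ^ k := by positivity
  have := Measure.integral_comp_div (fun ξ => Real.cos (2 ^ k * x * ξ) * ρ ξ) ((2 : ℝ) ^ k)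
  have h2 : ∀ ξ : ℝ, 2 ^ k * x * (ξ / 2 ^ k) = x * ξ := by intro ξ; field_simp
  simp only [h2] at this
  rw [abs_of_pos hk, smul_eq_mul] at this
  simp only [invFourier, kapk]
  rw [this]
  ring

lemma scaled_integrable {ρ : ℝ → ℝ} (hρ : IsLPCutoff ρ) (k : ℕ) :
    Integrable (fun ξ => ρ (ξ / 2 ^ k)) :=
  (rho_integrable hρ).comp_div (by positivity)

lemma lpSymbol_succ (ρ : ℝ → ℝ) (k : ℕ) :
    lpSymbol ρ (k + 1) = fun ξ => ρ (ξ / 2 ^ (k + 1)) - ρ (ξ / 2 ^ k) := by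
  ext ξ
  simp only [lpSymbol]
  congr 2
  rw [pow_succ]; field_simp

lemma lpSymbol_integrable {ρ : ℝ → ℝ} (hρ : IsLPCutoff ρ) (k : ℕ) :
    Integrable (lpSymbol ρ k) := by
  cases k with
  | zero => exact rho_integrable hρ
  | succ k =>
    rw [lpSymbol_succ]
    exact (scaled_integrable hρ _).sub (scaled_integrable hρ _)

lemma lpSymbol_continuous {ρ : ℝ → ℝ} (hρ : IsLPCutoff ρ) (k : ℕ) :
    Continuous (lpSymbol ρ k) := by
  have := hρ.smooth.continuous
  cases k with
  | zero => exact this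
  | succ k =>
    rw [lpSymbol_succ]
    fun_prop

lemma cos_mul_integrable {g : ℝ → ℝ} (hg : Integrable g) (x : ℝ) :
    Integrable (fun ξ => Real.cos (x * ξ) * g ξ) :=
  hg.bdd_mul (c := 1) (by fun_prop) (by
      filter_upwards with x; exact Real.abs_cos_le_one _)

lemma lpKernel_zero (ρ : ℝ → ℝ) : lpKernel ρ 0 = kapk ρ 0 := by
  ext x; simp [lpKernel, lpSymbol, kapk]

lemma lpKernel_succ {ρ : ℝ → ℝ} (hρ : IsLPCutoff ρ) (k : ℕ) (x : ℝ) :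
    lpKernel ρ (k + 1) x = kapk ρ (k + 1) x - kapk ρ k x := by
  rw [← invFourier_scale, ← invFourier_scale, lpKernel, lpSymbol_succ]
  simp only [invFourier, mul_sub]
  rw [integral_sub (cos_mul_integrable (scaled_integrable hρ _) x)
    (cos_mul_integrable (scaled_integrable hρ _) x)]
  ring

lemma sum_lpKernel {ρ : ℝ → ℝ} (hρ : IsLPCutoff ρ) (K : ℕ) (x : ℝ) :
    ∑ k ∈ Finset.range (K + 1), lpKernel ρ k x = kapk ρ K x := by
  induction K with
  | zero => simp [lpKernel_zero]
  | succ K ih => rw [Finset.sum_range_succ, ih, lpKernel_succ hρ]; ring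

lemma kapk_continuous {ρ : ℝ → ℝ} (hρ : IsLPCutoff ρ) (k : ℕ) : Continuous (kapk ρ k) := by
  have := (kap_fourier hρ).1
  unfold kapk; fun_prop

lemma kapk_integrable {ρ : ℝ → ℝ} (hρ : IsLPCutoff ρ) (k : ℕ) : Integrable (kapk ρ k) := by
  have := (kap_fourier hρ).2.1
  exact (this.comp_mul_left' (by positivity)).const_mul _

lemma kapk_even (ρ : ℝ → ℝ) (k : ℕ) (x : ℝ) : kapk ρ k (-x) = kapk ρ k x := by
  simp [kapk, invFourier]

lemma kapk_fourier {ρ : ℝ → ℝ} (hρ : IsLPCutoff ρ) (k : ℕ) (ξ : ℝ) :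
    ∫ z, kapk ρ k z * Real.cos (z * ξ) = Real.sqrt (2 * π) * ρ (ξ / 2 ^ k) := by
  have hk : (0 : ℝ) < 2 ^ k := by positivity
  rw [← (kap_fourier hρ).2.2]
  have := Measure.integral_comp_mul_left
    (fun z => invFourier ρ z * Real.cos (z * (ξ / 2 ^ k))) ((2 : ℝ) ^ k)
  rw [abs_of_pos (by positivity), smul_eq_mul] at this
  have h2 : ∀ z : ℝ, kapk ρ k z * Real.cos (z * ξ)
      = 2 ^ k * (invFourier ρ (2 ^ k * z) * Real.cos (2 ^ k * z * (ξ / 2 ^ k))) := by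
    intro z
    have : 2 ^ k * z * (ξ / 2 ^ k) = z * ξ := by field_simp
    rw [this, kapk]; ring
  simp_rw [h2]
  rw [integral_const_mul, this, mul_inv_cancel_left₀ hk.ne']

lemma kapk_L1 (ρ : ℝ → ℝ) (k : ℕ) : ∫ z, |kapk ρ k z| = ∫ z, |invFourier ρ z| := by
  have hk : (0 : ℝ) < 2 ^ k := by positivity
  have := Measure.integral_comp_mul_left (fun z => |invFourier ρ z|) ((2 : ℝ) ^ k)
  rw [abs_of_pos (by positivity), smul_eq_mul] at this
  simp only [kapk, abs_mul, abs_of_pos hk]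
  rw [integral_const_mul, this, mul_inv_cancel_left₀ hk.ne']

lemma lpK_continuous {ρ : ℝ → ℝ} (hρ : IsLPCutoff ρ) (k : ℕ) : Continuous (lpKernel ρ k) := by
  cases k with
  | zero => rw [lpKernel_zero]; exact kapk_continuous hρ 0
  | succ k =>
    rw [funext (lpKernel_succ hρ k)]
    exact (kapk_continuous hρ _).sub (kapk_continuous hρ _)

lemma lpK_integrable {ρ : ℝ → ℝ} (hρ : IsLPCutoff ρ) (k : ℕ) : Integrable (lpKernel ρ k) := by
  cases k with
  | zero => rw [lpKernel_zero]; exact kapk_integrable hρ 0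
  | succ k =>
    rw [funext (lpKernel_succ hρ k)]
    exact (kapk_integrable hρ _).sub (kapk_integrable hρ _)

lemma lpK_even (ρ : ℝ → ℝ) (k : ℕ) (x : ℝ) : lpKernel ρ k (-x) = lpKernel ρ k x := by
  simp [lpKernel, invFourier]

lemma mul_cos_integrable {g : ℝ → ℝ} (hg : Integrable g) (x : ℝ) :
    Integrable (fun ξ => g ξ * Real.cos (ξ * x)) :=
  hg.mul_bdd (c := 1) (by fun_prop) (by
      filter_upwards with x; exact Real.abs_cos_le_one _)

lemma lpK_fourier {ρ : ℝ → ℝ} (hρ : IsLPCutoff ρ) (k : ℕ) (ξ : ℝ) :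
    ∫ z, lpKernel ρ k z * Real.cos (z * ξ) = Real.sqrt (2 * π) * lpSymbol ρ k ξ := by
  cases k with
  | zero => rw [lpKernel_zero, kapk_fourier hρ]; simp [lpSymbol]
  | succ k =>
    rw [funext (lpKernel_succ hρ k), lpSymbol_succ]
    simp only [sub_mul]
    rw [integral_sub (mul_cos_integrable (kapk_integrable hρ _) _)
      (mul_cos_integrable (kapk_integrable hρ _) _), kapk_fourier hρ, kapk_fourier hρ]
    ring

def LL (ρ : ℝ → ℝ) : ℝ := 2 * ∫ z, |invFourier ρ z|

lemma LL_nonneg (ρ : ℝ → ℝ) : 0 ≤ LL ρ := by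
  unfold LL
  have : 0 ≤ ∫ z, |invFourier ρ z| := integral_nonneg (fun _ => abs_nonneg _)
  positivity

lemma lpK_L1 {ρ : ℝ → ℝ} (hρ : IsLPCutoff ρ) (k : ℕ) : ∫ z, |lpKernel ρ k z| ≤ LL ρ := by
  have h0 : 0 ≤ ∫ z, |invFourier ρ z| := integral_nonneg (fun _ => abs_nonneg _)
  unfold LL
  cases k with
  | zero => rw [lpKernel_zero, kapk_L1]; linarith
  | succ k =>
    have : ∫ z, |lpKernel ρ (k + 1) z| ≤ ∫ z, (|kapk ρ (k + 1) z| + |kapk ρ k z|) := by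
      refine integral_mono (lpK_integrable hρ _).abs
        ((kapk_integrable hρ _).abs.add (kapk_integrable hρ _).abs) ?_
      intro z
      simp only [lpKernel_succ hρ]
      exact abs_sub _ _
    rw [integral_add (kapk_integrable hρ _).abs (kapk_integrable hρ _).abs, kapk_L1, kapk_L1] at this
    linarith

lemma lpSymbol_supp {ρ : ℝ → ℝ} (hρ : IsLPCutoff ρ) (k : ℕ) (ξ : ℝ) (h : lpSymbol ρ k ξ ≠ 0) :
    |ξ| < 9 / 8 * 2 ^ k ∧ (k = 0 ∨ 7 / 16 * 2 ^ k < |ξ|) := by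
  have hz : ∀ k : ℕ, 9 / 8 * 2 ^ k ≤ |ξ| → ρ (ξ / 2 ^ k) = 0 := by
    intro k hk
    have hk' : (0 : ℝ) < 2 ^ k := by positivity
    apply hρ.eq_zero
    rw [abs_div, abs_of_pos hk', le_div_iff₀ hk']; exact hk
  have ho : ∀ k : ℕ, |ξ| ≤ 7 / 8 * 2 ^ k → ρ (ξ / 2 ^ k) = 1 := by
    intro k hk
    have hk' : (0 : ℝ) < 2 ^ k := by positivity
    apply hρ.eq_one
    rw [abs_div, abs_of_pos hk', div_le_iff₀ hk']; exact hk
  cases k with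
  | zero =>
    refine ⟨?_, Or.inl rfl⟩
    by_contra hc
    push Not at hc
    have := hz 0 hc
    simp [lpSymbol] at h this
    exact h this
  | succ k =>
    have hk' : (0 : ℝ) < 2 ^ k := by positivity
    rw [lpSymbol_succ] at h
    refine ⟨?_, Or.inr ?_⟩
    · by_contra hc
      push Not at hc
      apply h
      have h1 := hz (k + 1) hc
      have h2 := hz k (by rw [pow_succ] at hc; linarith)
      simp [h1, h2]
    · by_contra hc
      push Not at hc
      rw [pow_succ] at hc
      apply h
      have h1 := ho (k + 1) (by rw [pow_succ]; linarith)
      have h2 := ho k (by linarith)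
      simp [h1, h2]

/-- Admissible frequency interactions. -/
def Adm (n a b : ℕ) : Prop := n ≤ max a b + 2 ∧ a ≤ max n b + 2 ∧ b ≤ max n a + 2

lemma adm_aux {x y z : ℝ} {n a b : ℕ} (hx : n = 0 ∨ 7 / 16 * 2 ^ n < |x|)
    (hy : |y| < 9 / 8 * 2 ^ a) (hz : |z| < 9 / 8 * 2 ^ b) (hxyz : |x| ≤ |y| + |z|) :
    n ≤ max a b + 2 := by
  rcases hx with rfl | hx
  · omega
  have ha : (2 : ℝ) ^ a ≤ 2 ^ max a b := pow_le_pow_right₀ (by norm_num) (le_max_left _ _)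
  have hb : (2 : ℝ) ^ b ≤ 2 ^ max a b := pow_le_pow_right₀ (by norm_num) (le_max_right _ _)
  have h0 : (0 : ℝ) < 2 ^ max a b := by positivity
  have : (2 : ℝ) ^ n < 2 ^ (max a b + 3) := by
    rw [pow_add]; nlinarith
  have := (pow_lt_pow_iff_right₀ (by norm_num : (1 : ℝ) < 2)).1 this
  omega

lemma symbol_vanish {ρ : ℝ → ℝ} (hρ : IsLPCutoff ρ) {n a b : ℕ} (h : ¬ Adm n a b) (x y z : ℝ)
    (hx : |x| ≤ |y| + |z|) (hy : |y| ≤ |x| + |z|) (hz : |z| ≤ |x| + |y|) :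
    lpSymbol ρ n x * (lpSymbol ρ a y * lpSymbol ρ b z) = 0 := by
  by_contra hc
  simp only [mul_eq_zero, not_or] at hc
  obtain ⟨h1, h2, h3⟩ := hc
  obtain ⟨a1, b1⟩ := lpSymbol_supp hρ _ _ h1
  obtain ⟨a2, b2⟩ := lpSymbol_supp hρ _ _ h2
  obtain ⟨a3, b3⟩ := lpSymbol_supp hρ _ _ h3
  exact h ⟨adm_aux b1 a2 a3 hx, adm_aux b2 a1 a3 hy, adm_aux b3 a1 a2 hz⟩

lemma cos_shift {K σ : ℝ → ℝ} {c : ℝ} (hK : Integrable K) (hKe : ∀ x, K (-x) = K x)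
    (hσ : ∀ ξ, ∫ z, K z * Real.cos (z * ξ) = c * σ ξ) (θ ξ : ℝ) :
    ∫ z, K z * Real.cos (θ - z * ξ) = c * σ ξ * Real.cos θ := by
  have hi2 : Integrable (fun x => K x * Real.sin (x * ξ)) :=
    hK.mul_bdd (c := 1) (by fun_prop) (by
      filter_upwards with x; exact Real.abs_sin_le_one _)
  have h2 : ∫ x : ℝ, K x * Real.sin (x * ξ) = 0 := by
    have := integral_neg_eq_self (fun x => K x * Real.sin (x * ξ)) volume
    simp only [neg_mul, Real.sin_neg, hKe, mul_neg, integral_neg] at this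
    linarith
  have : ∀ z, K z * Real.cos (θ - z * ξ) =
      Real.cos θ * (K z * Real.cos (z * ξ)) + Real.sin θ * (K z * Real.sin (z * ξ)) := by
    intro z; rw [Real.cos_sub]; ring
  simp_rw [this]
  rw [integral_add ((mul_cos_integrable hK _).const_mul _) (hi2.const_mul _), integral_const_mul,
    integral_const_mul, h2, hσ]
  ring

lemma ker_vanish {ρ : ℝ → ℝ} (hρ : IsLPCutoff ρ) {n a b : ℕ} (h : ¬ Adm n a b) (s t : ℝ) :
    ∫ z, lpKernel ρ n z * (lpKernel ρ a (s - z) * lpKernel ρ b (t - z)) = 0 := by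
  set K := lpKernel ρ n
  set A := lpSymbol ρ a
  set B := lpSymbol ρ b
  have hK : Integrable K := lpK_integrable hρ n
  have hA : Integrable A := lpSymbol_integrable hρ a
  have hB : Integrable B := lpSymbol_integrable hρ b
  have e1 : ∀ z, K z * (lpKernel ρ a (s - z) * lpKernel ρ b (t - z)) =
      (Real.sqrt (2 * π))⁻¹ * (Real.sqrt (2 * π))⁻¹ * ∫ p : ℝ × ℝ, K z *
        (Real.cos ((s - z) * p.1) * A p.1 * (Real.cos ((t - z) * p.2) * B p.2)) := by
    intro z
    rw [integral_const_mul, Measure.volume_eq_prod,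
      integral_prod_mul (fun ξ => Real.cos ((s - z) * ξ) * A ξ)
      (fun ξ => Real.cos ((t - z) * ξ) * B ξ)]
    simp only [lpKernel, invFourier, A, B]
    ring
  simp_rw [e1]
  rw [integral_const_mul, integral_integral_swap]
  · refine mul_eq_zero_of_right _ (integral_eq_zero_of_ae (Filter.Eventually.of_forall fun p => ?_))
    simp only [Pi.zero_apply]
    have e2 : ∀ z, K z * (Real.cos ((s - z) * p.1) * A p.1 * (Real.cos ((t - z) * p.2) * B p.2))
      = (1 / 2 * (A p.1 * B p.2)) * (K z * Real.cos ((s * p.1 + t * p.2) - z * (p.1 + p.2)))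
        + (1 / 2 * (A p.1 * B p.2)) * (K z * Real.cos ((s * p.1 - t * p.2) - z * (p.1 - p.2))) := by
      intro z
      have g1 : (s * p.1 + t * p.2) - z * (p.1 + p.2) = (s - z) * p.1 + (t - z) * p.2 := by ring
      have g2 : (s * p.1 - t * p.2) - z * (p.1 - p.2) = (s - z) * p.1 - (t - z) * p.2 := by ring
      rw [g1, g2, Real.cos_add, Real.cos_sub]; ring
    simp_rw [e2]
    have hi : ∀ θ ξ : ℝ, Integrable (fun z => K z * Real.cos (θ - z * ξ)) := fun θ ξ =>
      hK.mul_bdd (c := 1) (by fun_prop) (by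
        filter_upwards with x; exact Real.abs_cos_le_one _)
    rw [integral_add ((hi _ _).const_mul _) ((hi _ _).const_mul _), integral_const_mul,
      integral_const_mul, cos_shift hK (lpK_even ρ n) (lpK_fourier hρ n),
      cos_shift hK (lpK_even ρ n) (lpK_fourier hρ n)]
    have v1 := symbol_vanish hρ h (p.1 + p.2) p.1 p.2 (abs_add_le _ _)
      (by have := abs_sub (p.1 + p.2) p.2; simpa using this)
      (by have := abs_sub (p.1 + p.2) p.1; simpa using this)
    have v2 := symbol_vanish hρ h (p.1 - p.2) p.1 p.2 (abs_sub _ _)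
      (by have := abs_add_le (p.1 - p.2) p.2; simpa using this)
      (by have := abs_sub (p.1 - p.2) p.1
          have e : p.1 - p.2 - p.1 = - p.2 := by ring
          rw [e, abs_neg] at this; exact this)
    linear_combination (1 / 2 * √(2 * π) * Real.cos (s * p.1 + t * p.2)) * v1 +
      (1 / 2 * √(2 * π) * Real.cos (s * p.1 - t * p.2)) * v2
  · have hI : Integrable (fun q : ℝ × (ℝ × ℝ) => K q.1 * (A q.2.1 * B q.2.2))
      (volume.prod volume) := hK.mul_prod (hA.mul_prod hB)
    have := hI.mul_bdd (c := 1)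
      (g := fun q : ℝ × (ℝ × ℝ) => Real.cos ((s - q.1) * q.2.1) * Real.cos ((t - q.1) * q.2.2))
      (Continuous.aestronglyMeasurable (by fun_prop)) (by
        filter_upwards with q
        rw [norm_mul]
        exact mul_le_one₀ (Real.abs_cos_le_one _) (norm_nonneg _) (Real.abs_cos_le_one _))
    refine this.congr ?_
    filter_upwards with q
    simp only [Function.uncurry]
    ring

/-- Bounded continuous functions. -/
def BC {X : Type*} [TopologicalSpace X] (f : X → ℝ) : Prop :=
  Continuous f ∧ ∃ C : ℝ, ∀ x, |f x| ≤ C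

lemma BC.comp {X Y : Type*} [TopologicalSpace X] [TopologicalSpace Y] {f : X → ℝ} (hf : BC f)
    {g : Y → X} (hg : Continuous g) : BC (fun y => f (g y)) :=
  ⟨hf.1.comp hg, hf.2.imp fun _ h y => h (g y)⟩

lemma BC.mul {X : Type*} [TopologicalSpace X] {f g : X → ℝ} (hf : BC f) (hg : BC g) :
    BC (fun x => f x * g x) := by
  obtain ⟨hf, C, hC⟩ := hf
  obtain ⟨hg, D, hD⟩ := hg
  refine ⟨hf.mul hg, C * D, fun x => ?_⟩
  rw [abs_mul]
  exact mul_le_mul (hC x) (hD x) (abs_nonneg _) ((abs_nonneg _).trans (hC x))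

lemma BC.sum {X ι : Type*} [TopologicalSpace X] {f : ι → X → ℝ} {s : Finset ι}
    (hf : ∀ i, BC (f i)) : BC (fun x => ∑ i ∈ s, f i x) := by
  choose hc C hC using hf
  exact ⟨continuous_finsetSum _ fun i _ => hc i, ∑ i ∈ s, C i, fun x =>
    (Finset.abs_sum_le_sum_abs _ _).trans (Finset.sum_le_sum fun i _ => hC i x)⟩

lemma BC.bound_nonneg {X : Type*} [TopologicalSpace X] {f : X → ℝ} (hf : BC f) :
    ∃ C : ℝ, 0 ≤ C ∧ ∀ x, |f x| ≤ C := by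
  obtain ⟨_, C, hC⟩ := hf
  exact ⟨max C 0, le_max_right _ _, fun x => (hC x).trans (le_max_left _ _)⟩

lemma BC.ker_integrable {f : ℝ → ℝ} (hf : BC f) {K : ℝ → ℝ} (hK : Integrable K) :
    Integrable (fun y => K y * f y) := by
  obtain ⟨hc, C, hC⟩ := hf
  exact hK.mul_bdd (c := C) hc.aestronglyMeasurable (Filter.Eventually.of_forall hC)

lemma ker_bound {f : ℝ → ℝ} {K : ℝ → ℝ} (hK : Integrable K) {C : ℝ}
    (hC : ∀ x, |f x| ≤ C) : |∫ y, K y * f y| ≤ (∫ y, |K y|) * C := by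
  rw [← integral_mul_const, ← Real.norm_eq_abs]
  refine norm_integral_le_of_norm_le (hK.abs.mul_const C) (Filter.Eventually.of_forall fun y => ?_)
  rw [norm_mul]
  exact mul_le_mul_of_nonneg_left (hC y) (abs_nonneg _)

lemma LP_bound {ρ : ℝ → ℝ} (hρ : IsLPCutoff ρ) (k : ℕ) {f : ℝ → ℝ} {C : ℝ}
    (hC : ∀ x, |f x| ≤ C) (x : ℝ) : |LP ρ k f x| ≤ LL ρ * C := by
  have hC0 : 0 ≤ C := (abs_nonneg _).trans (hC 0)
  refine (ker_bound (lpK_integrable hρ k) (f := fun y => f (x - y)) (C := C)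
    (fun y => hC _)).trans ?_
  exact mul_le_mul_of_nonneg_right (lpK_L1 hρ k) hC0

lemma LPu_eq (ρ : ℝ → ℝ) (k : ℕ) (F : ℝ × ℝ → ℝ) (p : ℝ × ℝ) :
    LPu ρ k F p = LP ρ k (fun x => F (x, p.2)) p.1 := rfl

lemma LPv_eq (ρ : ℝ → ℝ) (k : ℕ) (F : ℝ × ℝ → ℝ) (p : ℝ × ℝ) :
    LPv ρ k F p = LP ρ k (fun x => F (p.1, x)) p.2 := rfl

lemma LPu_bound {ρ : ℝ → ℝ} (hρ : IsLPCutoff ρ) (k : ℕ) {F : ℝ × ℝ → ℝ} {C : ℝ}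
    (hC : ∀ x, |F x| ≤ C) (p : ℝ × ℝ) : |LPu ρ k F p| ≤ LL ρ * C :=
  LP_bound hρ k (f := fun x => F (x, p.2)) (fun _ => hC _) p.1

lemma LPv_bound {ρ : ℝ → ℝ} (hρ : IsLPCutoff ρ) (k : ℕ) {F : ℝ × ℝ → ℝ} {C : ℝ}
    (hC : ∀ x, |F x| ≤ C) (p : ℝ × ℝ) : |LPv ρ k F p| ≤ LL ρ * C :=
  LP_bound hρ k (f := fun x => F (p.1, x)) (fun _ => hC _) p.2

lemma ker_continuous {X : Type*} [TopologicalSpace X] [FirstCountableTopology X]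
    {K : ℝ → ℝ} (hKc : Continuous K) (hK : Integrable K)
    {g : X × ℝ → ℝ} (hg : BC g) : Continuous (fun p => ∫ y, K y * g (p, y)) := by
  obtain ⟨hc, C, hC⟩ := hg
  refine continuous_of_dominated (bound := fun y => |K y| * C) ?_ ?_ (hK.abs.mul_const C) ?_
  · intro p
    exact Continuous.aestronglyMeasurable (by fun_prop)
  · intro p
    filter_upwards with y
    rw [norm_mul]
    exact mul_le_mul_of_nonneg_left (hC _) (abs_nonneg _)
  · filter_upwards with y
    fun_prop

lemma LPu_BC {ρ : ℝ → ℝ} (hρ : IsLPCutoff ρ) (k : ℕ) {F : ℝ × ℝ → ℝ} (hF : BC F) :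
    BC (LPu ρ k F) := by
  refine ⟨?_, ?_⟩
  · exact ker_continuous (lpK_continuous hρ k) (lpK_integrable hρ k)
      (g := fun q : (ℝ × ℝ) × ℝ => F (q.1.1 - q.2, q.1.2)) (hF.comp (by fun_prop))
  · obtain ⟨_, C, hC⟩ := hF
    exact ⟨LL ρ * C, LPu_bound hρ k hC⟩

lemma LPv_BC {ρ : ℝ → ℝ} (hρ : IsLPCutoff ρ) (k : ℕ) {F : ℝ × ℝ → ℝ} (hF : BC F) :
    BC (LPv ρ k F) := by
  refine ⟨?_, ?_⟩
  · exact ker_continuous (lpK_continuous hρ k) (lpK_integrable hρ k)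
      (g := fun q : (ℝ × ℝ) × ℝ => F (q.1.1, q.1.2 - q.2)) (hF.comp (by fun_prop))
  · obtain ⟨_, C, hC⟩ := hF
    exact ⟨LL ρ * C, LPv_bound hρ k hC⟩

lemma LP_comm {ρ : ℝ → ℝ} (hρ : IsLPCutoff ρ) (j k : ℕ) {F : ℝ × ℝ → ℝ} (hF : BC F) :
    LPu ρ j (LPv ρ k F) = LPv ρ k (LPu ρ j F) := by
  ext p
  simp only [LPu, LPv]
  simp_rw [← integral_const_mul]
  rw [integral_integral_swap]
  · congr 1; ext w; congr 1; ext y; ring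
  · obtain ⟨hc, C, hC⟩ := hF
    have := ((lpK_integrable hρ j).mul_prod (lpK_integrable hρ k)).mul_bdd (c := C)
      (g := fun q : ℝ × ℝ => F (p.1 - q.1, p.2 - q.2))
      (Continuous.aestronglyMeasurable (by fun_prop)) (Filter.Eventually.of_forall fun q => hC _)
    refine this.congr (Filter.Eventually.of_forall fun q => ?_)
    simp only [Function.uncurry]
    ring

lemma LP_vanish {ρ : ℝ → ℝ} (hρ : IsLPCutoff ρ) {n a b : ℕ} (h : ¬ Adm n a b) {f g : ℝ → ℝ}
    (hf : BC f) (hg : BC g) (x : ℝ) :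
    LP ρ n (fun x => LP ρ a f x * LP ρ b g x) x = 0 := by
  have hKa := lpK_integrable hρ a
  have hKb := lpK_integrable hρ b
  have hKn := lpK_integrable hρ n
  have ca := lpK_continuous hρ a
  have cb := lpK_continuous hρ b
  have cn := lpK_continuous hρ n
  have e0 : ∀ (k : ℕ) (f : ℝ → ℝ) (z : ℝ), LP ρ k f (x - z) =
      ∫ s, lpKernel ρ k (s - z) * f (x - s) := by
    intro k f z
    have := integral_sub_right_eq_self (μ := volume) (fun y => lpKernel ρ k y * f (x - z - y)) z
    rw [LP, ← this]
    congr 1; ext s; congr 2; ring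
  have e1 : ∀ z, lpKernel ρ n z * (LP ρ a f (x - z) * LP ρ b g (x - z)) =
      ∫ p : ℝ × ℝ, lpKernel ρ n z * ((lpKernel ρ a (p.1 - z) * f (x - p.1)) *
        (lpKernel ρ b (p.2 - z) * g (x - p.2))) := by
    intro z
    rw [e0, e0, integral_const_mul, Measure.volume_eq_prod,
      integral_prod_mul (fun s => lpKernel ρ a (s - z) * f (x - s))
        (fun s => lpKernel ρ b (s - z) * g (x - s))]
  rw [LP]
  simp_rw [e1]
  rw [integral_integral_swap]
  · refine integral_eq_zero_of_ae (Filter.Eventually.of_forall fun p => ?_)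
    have : ∀ z, lpKernel ρ n z * ((lpKernel ρ a (p.1 - z) * f (x - p.1)) *
        (lpKernel ρ b (p.2 - z) * g (x - p.2))) =
        (f (x - p.1) * g (x - p.2)) *
        (lpKernel ρ n z * (lpKernel ρ a (p.1 - z) * lpKernel ρ b (p.2 - z))) := by
      intro z; ring
    simp only [this, Pi.zero_apply]
    rw [integral_const_mul, ker_vanish hρ h, mul_zero]
  · have hI : Integrable (fun q : ℝ × (ℝ × ℝ) => lpKernel ρ n q.1 *
        (lpKernel ρ a (q.2.1 - q.1) * lpKernel ρ b (q.2.2 - q.1))) (volume.prod volume) := by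
      rw [integrable_prod_iff (Continuous.aestronglyMeasurable (by fun_prop))]
      constructor
      · filter_upwards with z
        exact ((hKa.comp_sub_right z).mul_prod (hKb.comp_sub_right z)).const_mul _
      · have e2 : ∀ z, ∫ p : ℝ × ℝ, ‖lpKernel ρ n z *
            (lpKernel ρ a (p.1 - z) * lpKernel ρ b (p.2 - z))‖ =
            |lpKernel ρ n z| * ((∫ s, |lpKernel ρ a s|) * ∫ s, |lpKernel ρ b s|) := by
          intro z
          simp only [norm_mul, Real.norm_eq_abs]
          rw [integral_const_mul, Measure.volume_eq_prod,
            integral_prod_mul (fun s => |lpKernel ρ a (s - z)|) (fun s => |lpKernel ρ b (s - z)|),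
            integral_sub_right_eq_self (fun s => |lpKernel ρ a s|),
            integral_sub_right_eq_self (fun s => |lpKernel ρ b s|)]
        simp_rw [e2]
        exact hKn.abs.mul_const _
    obtain ⟨hc, C, hC⟩ := (hf.comp (g := fun q : ℝ × (ℝ × ℝ) => x - q.2.1) (by fun_prop)).mul
      (hg.comp (g := fun q : ℝ × (ℝ × ℝ) => x - q.2.2) (by fun_prop))
    have := hI.mul_bdd (c := C) hc.aestronglyMeasurable (Filter.Eventually.of_forall hC)
    refine this.congr (Filter.Eventually.of_forall fun q => ?_)
    simp only [Function.uncurry]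
    ring

lemma LP_zero (ρ : ℝ → ℝ) (k : ℕ) (x : ℝ) : LP ρ k (fun _ => 0) x = 0 := by simp [LP]

lemma LPu_zero (ρ : ℝ → ℝ) (k : ℕ) (F : ℝ × ℝ → ℝ) (h : ∀ p, F p = 0) (p : ℝ × ℝ) :
    LPu ρ k F p = 0 := by simp [LPu, h]

lemma LPv_zero (ρ : ℝ → ℝ) (k : ℕ) (F : ℝ × ℝ → ℝ) (h : ∀ p, F p = 0) (p : ℝ × ℝ) :
    LPv ρ k F p = 0 := by simp [LPv, h]

lemma block_zero {ρ : ℝ → ℝ} (hρ : IsLPCutoff ρ) {F G : ℝ × ℝ → ℝ} (hF : BC F) (hG : BC G)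
    {n₁ a₁ b₁ n₂ a₂ b₂ : ℕ} (h : ¬ (Adm n₁ a₁ b₁ ∧ Adm n₂ a₂ b₂)) (p : ℝ × ℝ) :
    LPu ρ n₁ (LPv ρ n₂ (fun p => LPu ρ a₁ (LPv ρ a₂ F) p * LPu ρ b₁ (LPv ρ b₂ G) p)) p = 0 := by
  have hFv := LPv_BC hρ a₂ hF
  have hGv := LPv_BC hρ b₂ hG
  have hFu := LPu_BC hρ a₁ hF
  have hGu := LPu_BC hρ b₁ hG
  rw [not_and_or] at h
  rcases h with h | h
  · rw [LP_comm hρ _ _ ((LPu_BC hρ _ hFv).mul (LPu_BC hρ _ hGv))]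
    apply LPv_zero
    intro p
    exact LP_vanish hρ h (f := fun x => LPv ρ a₂ F (x, p.2)) (g := fun x => LPv ρ b₂ G (x, p.2))
      (hFv.comp (by fun_prop)) (hGv.comp (by fun_prop)) p.1
  · rw [LP_comm hρ _ _ hF, LP_comm hρ _ _ hG]
    apply LPu_zero
    intro p
    exact LP_vanish hρ h (f := fun x => LPu ρ a₁ F (p.1, x)) (g := fun x => LPu ρ b₁ G (p.1, x))
      (hFu.comp (by fun_prop)) (hGu.comp (by fun_prop)) p.2

lemma LP_sum {ρ : ℝ → ℝ} (hρ : IsLPCutoff ρ) (k : ℕ) {ι : Type*} (s : Finset ι)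
    {H : ι → ℝ → ℝ} (hH : ∀ i, BC (H i)) (x : ℝ) :
    LP ρ k (fun y => ∑ i ∈ s, H i y) x = ∑ i ∈ s, LP ρ k (H i) x := by
  simp only [LP, Finset.mul_sum]
  exact integral_finsetSum _ fun i _ =>
    ((hH i).comp (g := fun y => x - y) (by fun_prop)).ker_integrable (lpK_integrable hρ k)

lemma LPu_sum {ρ : ℝ → ℝ} (hρ : IsLPCutoff ρ) (k : ℕ) {ι : Type*} (s : Finset ι)
    {H : ι → ℝ × ℝ → ℝ} (hH : ∀ i, BC (H i)) :
    LPu ρ k (fun y => ∑ i ∈ s, H i y) = fun p => ∑ i ∈ s, LPu ρ k (H i) p := by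
  ext p
  exact LP_sum hρ k s (H := fun i x => H i (x, p.2)) (fun i => (hH i).comp (by fun_prop)) p.1

lemma LPv_sum {ρ : ℝ → ℝ} (hρ : IsLPCutoff ρ) (k : ℕ) {ι : Type*} (s : Finset ι)
    {H : ι → ℝ × ℝ → ℝ} (hH : ∀ i, BC (H i)) :
    LPv ρ k (fun y => ∑ i ∈ s, H i y) = fun p => ∑ i ∈ s, LPv ρ k (H i) p := by
  ext p
  exact LP_sum hρ k s (H := fun i x => H i (p.1, x)) (fun i => (hH i).comp (by fun_prop)) p.2

lemma LP_tendsto {ρ : ℝ → ℝ} (hρ : IsLPCutoff ρ) (k : ℕ) {H : ℕ → ℝ → ℝ} {h : ℝ → ℝ} {C : ℝ}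
    (hH : ∀ i, BC (H i)) (hC : ∀ i x, |H i x| ≤ C)
    (hl : ∀ x, Filter.Tendsto (fun i => H i x) Filter.atTop (nhds (h x))) (x : ℝ) :
    Filter.Tendsto (fun i => LP ρ k (H i) x) Filter.atTop (nhds (LP ρ k h x)) := by
  refine tendsto_integral_of_dominated_convergence (fun y => |lpKernel ρ k y| * C) ?_
    ((lpK_integrable hρ k).abs.mul_const C) ?_ ?_
  · intro i
    exact (((hH i).comp (g := fun y => x - y) (by fun_prop)).ker_integrable
      (lpK_integrable hρ k)).aestronglyMeasurable
  · intro i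
    filter_upwards with y
    rw [norm_mul]
    exact mul_le_mul_of_nonneg_left (hC _ _) (abs_nonneg _)
  · filter_upwards with y
    exact (hl _).const_mul _

lemma LPuv_tendsto {ρ : ℝ → ℝ} (hρ : IsLPCutoff ρ) (j k : ℕ) {H : ℕ → ℝ × ℝ → ℝ}
    {h : ℝ × ℝ → ℝ} {C : ℝ}
    (hH : ∀ i, BC (H i)) (hC : ∀ i x, |H i x| ≤ C)
    (hl : ∀ x, Filter.Tendsto (fun i => H i x) Filter.atTop (nhds (h x))) (p : ℝ × ℝ) :
    Filter.Tendsto (fun i => LPu ρ j (LPv ρ k (H i)) p) Filter.atTop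
      (nhds (LPu ρ j (LPv ρ k h) p)) := by
  refine LP_tendsto hρ j (H := fun i x => LPv ρ k (H i) (x, p.2))
    (h := fun x => LPv ρ k h (x, p.2)) (C := LL ρ * C)
    (fun i => (LPv_BC hρ k (hH i)).comp (by fun_prop)) (fun i x => LPv_bound hρ k (hC i) _) ?_ p.1
  intro x
  exact LP_tendsto hρ k (H := fun i y => H i (x, y)) (h := fun y => h (x, y))
    (fun i => (hH i).comp (by fun_prop)) (fun i x => hC i _) (fun y => hl _) p.2

/-- Partial Littlewood-Paley sums. -/
def FK (ρ : ℝ → ℝ) (K : ℕ) (F : ℝ × ℝ → ℝ) (p : ℝ × ℝ) : ℝ :=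
  ∑ a₁ ∈ Finset.range (K + 1), ∑ a₂ ∈ Finset.range (K + 1), LPu ρ a₁ (LPv ρ a₂ F) p

lemma sum_LP {ρ : ℝ → ℝ} (hρ : IsLPCutoff ρ) (K : ℕ) {f : ℝ → ℝ} (hf : BC f) (x : ℝ) :
    ∑ k ∈ Finset.range (K + 1), LP ρ k f x = ∫ w, invFourier ρ w * f (x - w / 2 ^ K) := by
  have hk : (0 : ℝ) < 2 ^ K := by positivity
  simp only [LP]
  rw [← integral_finsetSum _ fun i _ =>
    (hf.comp (g := fun y => x - y) (by fun_prop)).ker_integrable (lpK_integrable hρ i)]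
  simp_rw [← Finset.sum_mul, sum_lpKernel hρ]
  have := Measure.integral_comp_mul_left (fun w => invFourier ρ w * f (x - w / 2 ^ K)) ((2 : ℝ) ^ K)
  rw [abs_of_pos (by positivity), smul_eq_mul, eq_comm, inv_mul_eq_iff_eq_mul₀ hk.ne',
    ← integral_const_mul] at this
  rw [this]
  congr 1; ext w
  have : 2 ^ K * w / 2 ^ K = w := by field_simp
  rw [this, kapk]; ring

lemma FK_eq {ρ : ℝ → ℝ} (hρ : IsLPCutoff ρ) (K : ℕ) {F : ℝ × ℝ → ℝ} (hF : BC F) (p : ℝ × ℝ) :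
    FK ρ K F p = ∫ y, invFourier ρ y *
      ∫ w, invFourier ρ w * F (p.1 - y / 2 ^ K, p.2 - w / 2 ^ K) := by
  have h1 : FK ρ K F p = ∑ a₁ ∈ Finset.range (K + 1), LPu ρ a₁
      (fun p => ∑ a₂ ∈ Finset.range (K + 1), LPv ρ a₂ F p) p := by
    simp only [FK]
    refine Finset.sum_congr rfl fun a₁ _ => ?_
    rw [LPu_sum hρ _ _ fun i => LPv_BC hρ i hF]
  rw [h1]
  have hb : BC (fun p => ∑ a₂ ∈ Finset.range (K + 1), LPv ρ a₂ F p) :=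
    BC.sum fun i => LPv_BC hρ i hF
  have h2 := sum_LP hρ K (hb.comp (g := fun x : ℝ => (x, p.2)) (by fun_prop)) p.1
  rw [show ∑ a₁ ∈ Finset.range (K + 1), LPu ρ a₁
      (fun p => ∑ a₂ ∈ Finset.range (K + 1), LPv ρ a₂ F p) p = _ from h2]
  congr 1; ext y; congr 1
  exact sum_LP hρ K (hF.comp (g := fun x : ℝ => (p.1 - y / 2 ^ K, x)) (by fun_prop)) p.2

lemma FK_BC {ρ : ℝ → ℝ} (hρ : IsLPCutoff ρ) (K : ℕ) {F : ℝ × ℝ → ℝ} (hF : BC F) :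
    BC (FK ρ K F) :=
  BC.sum fun _ => BC.sum fun _ => LPu_BC hρ _ (LPv_BC hρ _ hF)

lemma FK_bound {ρ : ℝ → ℝ} (hρ : IsLPCutoff ρ) {F : ℝ × ℝ → ℝ} (hF : BC F) :
    ∃ C, 0 ≤ C ∧ ∀ K p, |FK ρ K F p| ≤ C := by
  obtain ⟨C, h0, hC⟩ := hF.bound_nonneg
  have hi := (kap_fourier hρ).2.1
  have hI : 0 ≤ ∫ y, |invFourier ρ y| := integral_nonneg fun _ => abs_nonneg _
  refine ⟨(∫ y, |invFourier ρ y|) * ((∫ y, |invFourier ρ y|) * C), by positivity, fun K p => ?_⟩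
  rw [FK_eq hρ K hF]
  exact ker_bound hi fun y => ker_bound hi fun w => hC _

lemma kap_integral {ρ : ℝ → ℝ} (hρ : IsLPCutoff ρ) : ∫ z, invFourier ρ z = Real.sqrt (2 * π) := by
  have := (kap_fourier hρ).2.2 0
  simpa [hρ.eq_one 0 (by norm_num)] using this

lemma FK_tendsto {ρ : ℝ → ℝ} (hρ : IsLPCutoff ρ) {F : ℝ × ℝ → ℝ} (hF : BC F) (p : ℝ × ℝ) :
    Filter.Tendsto (fun K => FK ρ K F p) Filter.atTop (nhds (2 * π * F p)) := by
  obtain ⟨C, h0, hC⟩ := hF.bound_nonneg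
  have hi := (kap_fourier hρ).2.1
  have hkc := (kap_fourier hρ).1
  have hFc := hF.1
  simp_rw [FK_eq hρ _ hF]
  have e : 2 * π * F p = ∫ y, invFourier ρ y * ∫ w, invFourier ρ w * F p := by
    rw [integral_mul_const, integral_mul_const, kap_integral hρ, ← mul_assoc,
      Real.mul_self_sqrt (by positivity)]
  rw [e]
  have hz : ∀ y : ℝ, Filter.Tendsto (fun K : ℕ => y / 2 ^ K) Filter.atTop (nhds 0) := by
    intro y
    have := (tendsto_pow_atTop_nhds_zero_of_lt_one (r := (1 / 2 : ℝ)) (by norm_num)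
      (by norm_num)).const_mul y
    simpa [div_eq_mul_inv] using this
  refine tendsto_integral_of_dominated_convergence
    (fun y => |invFourier ρ y| * ((∫ y, |invFourier ρ y|) * C)) ?_ (hi.abs.mul_const _) ?_ ?_
  · intro K
    refine Continuous.aestronglyMeasurable (hkc.mul ?_)
    exact ker_continuous hkc hi
      (g := fun q : ℝ × ℝ => F (p.1 - q.1 / 2 ^ K, p.2 - q.2 / 2 ^ K)) (hF.comp (by fun_prop))
  · intro K
    filter_upwards with y
    rw [norm_mul]
    exact mul_le_mul_of_nonneg_left (ker_bound hi fun w => hC _) (abs_nonneg _)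
  · filter_upwards with y
    refine Filter.Tendsto.const_mul _ ?_
    refine tendsto_integral_of_dominated_convergence
      (fun y => |invFourier ρ y| * C) ?_ (hi.abs.mul_const _) ?_ ?_
    · intro K
      exact Continuous.aestronglyMeasurable (by fun_prop)
    · intro K
      filter_upwards with w
      rw [norm_mul]
      exact mul_le_mul_of_nonneg_left (hC _) (abs_nonneg _)
    · filter_upwards with w
      refine Filter.Tendsto.const_mul _ ?_
      have h1 : Filter.Tendsto (fun K : ℕ => (p.1 - y / 2 ^ K, p.2 - w / 2 ^ K)) Filter.atTop
          (nhds (p.1 - 0, p.2 - 0)) :=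
        (((hz y).const_sub p.1)).prodMk_nhds ((hz w).const_sub p.2)
      rw [sub_zero, sub_zero] at h1
      exact (hFc.tendsto p).comp h1

lemma CbSmooth.bc {F : ℝ × ℝ → ℝ} (h : CbSmooth F) : BC F := by
  refine ⟨h.1.continuous, ?_⟩
  obtain ⟨C, hC⟩ := h.2 0
  exact ⟨C, fun x => by simpa using hC x⟩

lemma near_pow {p : ℝ} (hp : 0 < p) : ∃ D : ℝ, 0 ≤ D ∧ ∀ n a : ℕ, n ≤ a + 2 → a ≤ n + 2 →
    p ^ a ≤ D * p ^ n := by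
  refine ⟨max p p⁻¹ ^ 2, by positivity, fun n a h1 h2 => ?_⟩
  have hM1 : 1 ≤ max p p⁻¹ := by
    rcases le_total 1 p with h | h
    · exact h.trans (le_max_left _ _)
    · exact ((one_le_inv₀ hp).2 h).trans (le_max_right _ _)
  rcases le_total n a with h | h
  · obtain ⟨d, rfl⟩ := Nat.exists_eq_add_of_le h
    rw [pow_add, mul_comm]
    refine mul_le_mul_of_nonneg_right ?_ (by positivity)
    exact (pow_le_pow_left₀ hp.le (le_max_left p p⁻¹) d).trans
      (pow_le_pow_right₀ hM1 (by omega))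
  · obtain ⟨d, rfl⟩ := Nat.exists_eq_add_of_le h
    have : p ^ a = p⁻¹ ^ d * p ^ (a + d) := by
      rw [pow_add, inv_pow]; field_simp
    rw [this]
    refine mul_le_mul_of_nonneg_right ?_ (by positivity)
    exact (pow_le_pow_left₀ (inv_pos.2 hp).le (le_max_right p p⁻¹) d).trans
      (pow_le_pow_right₀ hM1 (by omega))

lemma near_sum {p : ℝ} (hp : 0 < p) : ∃ D : ℝ, 0 ≤ D ∧ ∀ n K : ℕ,
    ∑ a ∈ Finset.range K, (if n ≤ a + 2 ∧ a ≤ n + 2 then p ^ a else 0) ≤ D * p ^ n := by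
  obtain ⟨D, hD, h⟩ := near_pow hp
  refine ⟨5 * D, by positivity, fun n K => ?_⟩
  rw [← Finset.sum_filter]
  have h1 : ∀ a ∈ (Finset.range K).filter (fun a => n ≤ a + 2 ∧ a ≤ n + 2), p ^ a ≤ D * p ^ n := by
    intro a ha
    obtain ⟨_, h2, h3⟩ := Finset.mem_filter.1 ha
    exact h n a h2 h3
  have h2 := Finset.sum_le_card_nsmul _ _ _ h1
  have h3 : ((Finset.range K).filter (fun a => n ≤ a + 2 ∧ a ≤ n + 2)).card ≤ 5 := by
    have : (Finset.range K).filter (fun a => n ≤ a + 2 ∧ a ≤ n + 2) ⊆ Finset.Icc (n - 2) (n + 2) := by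
      intro a ha
      obtain ⟨_, h2, h3⟩ := Finset.mem_filter.1 ha
      rw [Finset.mem_Icc]; omega
    have := Finset.card_le_card this
    rw [Nat.card_Icc] at this
    omega
  rw [nsmul_eq_mul] at h2
  refine h2.trans ?_
  rw [mul_assoc]
  refine mul_le_mul_of_nonneg_right (by exact_mod_cast h3) (by positivity)

lemma low_sum {p q r : ℝ} (hp : 0 < p) (hq : 0 < q) (hq1 : q ≠ 1) (hpq : p * q < 1)
    (hpr : p ≤ r) (hqr : q ≤ r) : ∃ E : ℝ, 0 ≤ E ∧ ∀ n K : ℕ,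
    p ^ n * ∑ b ∈ Finset.range K, (if b ≤ n + 2 then q ^ b else 0) ≤ E * r ^ n := by
  have h0 : ∀ n K : ℕ, ∑ b ∈ Finset.range K, (if b ≤ n + 2 then q ^ b else 0) ≤
      ∑ b ∈ Finset.range (n + 3), q ^ b := by
    intro n K
    rw [← Finset.sum_filter]
    refine Finset.sum_le_sum_of_subset_of_nonneg ?_ (fun _ _ _ => by positivity)
    intro b hb
    obtain ⟨_, h2⟩ := Finset.mem_filter.1 hb
    rw [Finset.mem_range]; omega
  rcases lt_or_gt_of_ne hq1 with h | h
  · have h1 : 0 < 1 - q := by linarith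
    refine ⟨1 / (1 - q), by positivity, fun n K => ?_⟩
    rw [mul_comm]
    refine mul_le_mul ((h0 n K).trans ?_) (pow_le_pow_left₀ hp.le hpr n) (by positivity)
      (by positivity)
    rw [le_div_iff₀ h1, geom_sum_mul_neg]
    have : 0 < q ^ (n + 3) := by positivity
    linarith
  · have h1 : 0 < q - 1 := by linarith
    refine ⟨q ^ 3 / (q - 1), by positivity, fun n K => ?_⟩
    have h2 : ∑ b ∈ Finset.range (n + 3), q ^ b ≤ q ^ 3 / (q - 1) * q ^ n := by
      rw [div_mul_eq_mul_div, le_div_iff₀ h1, geom_sum_mul, pow_add]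
      nlinarith
    calc _ ≤ p ^ n * (q ^ 3 / (q - 1) * q ^ n) :=
          mul_le_mul_of_nonneg_left ((h0 n K).trans h2) (by positivity)
      _ = q ^ 3 / (q - 1) * (p * q) ^ n := by rw [mul_pow]; ring
      _ ≤ _ := mul_le_mul_of_nonneg_left (pow_le_pow_left₀ (by positivity) (by linarith) n)
          (by positivity)

lemma high_sum {t : ℝ} (ht : 0 < t) (ht1 : t < 1) : ∃ E : ℝ, 0 ≤ E ∧ ∀ n K : ℕ,
    ∑ a ∈ Finset.range K, (if n ≤ a + 2 then t ^ a else 0) ≤ E * t ^ n := by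
  obtain ⟨D, hD, h⟩ := near_pow ht
  have h1 : 0 < 1 - t := by linarith
  refine ⟨D / (1 - t), by positivity, fun n K => ?_⟩
  rw [← Finset.sum_filter]
  calc _ ≤ ∑ a ∈ Finset.Ico (n - 2) K, t ^ a := by
        refine Finset.sum_le_sum_of_subset_of_nonneg ?_ (fun _ _ _ => by positivity)
        intro b hb
        obtain ⟨h1, h2⟩ := Finset.mem_filter.1 hb
        rw [Finset.mem_range] at h1
        rw [Finset.mem_Ico]; omega
    _ ≤ t ^ (n - 2) / (1 - t) := geom_sum_Ico_le_of_lt_one ht.le ht1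
    _ ≤ D * t ^ n / (1 - t) := by
        gcongr
        exact h n (n - 2) (by omega) (by omega)
    _ = _ := by ring

lemma adm_sum {p q r : ℝ} (hp : 0 < p) (hq : 0 < q) (hp1 : p ≠ 1) (hq1 : q ≠ 1) (hpq : p * q < 1)
    (hpr : p ≤ r) (hqr : q ≤ r) : ∃ C : ℝ, 0 ≤ C ∧ ∀ n K : ℕ,
    ∑ a ∈ Finset.range K, ∑ b ∈ Finset.range K, (if Adm n a b then p ^ a * q ^ b else 0)
      ≤ C * r ^ n := by
  obtain ⟨D₁, hD₁, h₁⟩ := near_sum hp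
  obtain ⟨D₂, hD₂, h₂⟩ := near_sum hq
  obtain ⟨E₁, hE₁, g₁⟩ := low_sum hp hq hq1 hpq hpr hqr
  obtain ⟨E₂, hE₂, g₂⟩ := low_sum hq hp hp1 (by linarith [mul_comm p q]) hqr hpr
  obtain ⟨E₃, hE₃, g₃⟩ := high_sum (mul_pos hp hq) hpq
  have hr : 0 < r := hp.trans_le hpr
  have hpqr : p * q ≤ r := by
    rcases le_total p 1 with h | h
    · nlinarith
    · have : q ≤ 1 := by nlinarith
      nlinarith
  refine ⟨D₁ * E₁ + D₂ * E₂ + D₂ * E₃, by positivity, fun n K => ?_⟩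
  let R := Finset.range K
  let N : ℝ → ℕ → ℕ → ℝ := fun x n a => if n ≤ a + 2 ∧ a ≤ n + 2 then x ^ a else 0
  let Lo : ℝ → ℕ → ℝ := fun x b => if b ≤ n + 2 then x ^ b else 0
  let Hi : ℕ → ℝ := fun b => if n ≤ b + 2 then p ^ b else 0
  have hpt : ∀ a b, (if Adm n a b then p ^ a * q ^ b else 0) ≤
      N p n a * Lo q b + Lo p a * N q n b + Hi a * N q a b := by
    intro a b
    have n1 : 0 ≤ N p n a * Lo q b := by dsimp only [N, Lo]; positivity
    have n2 : 0 ≤ Lo p a * N q n b := by dsimp only [N, Lo]; positivity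
    have n3 : 0 ≤ Hi a * N q a b := by dsimp only [N, Hi]; positivity
    split_ifs with h
    · have hc : ((n ≤ a + 2 ∧ a ≤ n + 2) ∧ b ≤ n + 2) ∨ (a ≤ n + 2 ∧ (n ≤ b + 2 ∧ b ≤ n + 2)) ∨
          (n ≤ a + 2 ∧ (a ≤ b + 2 ∧ b ≤ a + 2)) := by
        unfold Adm at h; omega
      rcases hc with ⟨c1, c2⟩ | ⟨c1, c2⟩ | ⟨c1, c2⟩
      · have : N p n a * Lo q b = p ^ a * q ^ b := by dsimp only [N, Lo]; rw [if_pos c1, if_pos c2]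
        linarith
      · have : Lo p a * N q n b = p ^ a * q ^ b := by dsimp only [N, Lo]; rw [if_pos c1, if_pos c2]
        linarith
      · have : Hi a * N q a b = p ^ a * q ^ b := by dsimp only [N, Hi]; rw [if_pos c1, if_pos c2]
        linarith
    · linarith
  have s1 : ∑ a ∈ R, ∑ b ∈ R, N p n a * Lo q b ≤ D₁ * E₁ * r ^ n := by
    rw [← Finset.sum_mul_sum]
    calc _ ≤ (D₁ * p ^ n) * ∑ b ∈ R, Lo q b :=
          mul_le_mul_of_nonneg_right (h₁ n K)
            (Finset.sum_nonneg fun b _ => by dsimp only [Lo]; positivity)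
      _ = D₁ * (p ^ n * ∑ b ∈ R, Lo q b) := by ring
      _ ≤ D₁ * (E₁ * r ^ n) := mul_le_mul_of_nonneg_left (g₁ n K) hD₁
      _ = _ := by ring
  have s2 : ∑ a ∈ R, ∑ b ∈ R, Lo p a * N q n b ≤ D₂ * E₂ * r ^ n := by
    rw [← Finset.sum_mul_sum]
    calc _ ≤ (∑ b ∈ R, Lo p b) * (D₂ * q ^ n) :=
          mul_le_mul_of_nonneg_left (h₂ n K)
            (Finset.sum_nonneg fun b _ => by dsimp only [Lo]; positivity)
      _ = D₂ * (q ^ n * ∑ b ∈ R, Lo p b) := by ring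
      _ ≤ D₂ * (E₂ * r ^ n) := mul_le_mul_of_nonneg_left (g₂ n K) hD₂
      _ = _ := by ring
  have s3 : ∑ a ∈ R, ∑ b ∈ R, Hi a * N q a b ≤ D₂ * E₃ * r ^ n := by
    simp_rw [← Finset.mul_sum]
    calc _ ≤ ∑ a ∈ R, Hi a * (D₂ * q ^ a) :=
          Finset.sum_le_sum fun a _ => mul_le_mul_of_nonneg_left (h₂ a K)
            (by dsimp only [Hi]; positivity)
      _ = D₂ * ∑ a ∈ R, (if n ≤ a + 2 then (p * q) ^ a else 0) := by
          rw [Finset.mul_sum]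
          refine Finset.sum_congr rfl fun a _ => ?_
          dsimp only [Hi]
          split_ifs
          · rw [mul_pow]; ring
          · ring
      _ ≤ D₂ * (E₃ * (p * q) ^ n) := mul_le_mul_of_nonneg_left (g₃ n K) hD₂
      _ ≤ D₂ * (E₃ * r ^ n) := by gcongr
      _ = _ := by ring
  calc _ ≤ ∑ a ∈ R, ∑ b ∈ R, (N p n a * Lo q b + Lo p a * N q n b + Hi a * N q a b) :=
        Finset.sum_le_sum fun a _ => Finset.sum_le_sum fun b _ => hpt a b
    _ ≤ _ := by
        simp_rw [Finset.sum_add_distrib]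
        linarith

/-- Same with the family index. -/
lemma adm_sum_family {p q r : ℝ} (hp : 0 < p) (hq : 0 < q) (hp1 : p ≠ 1) (hq1 : q ≠ 1)
    (hpq : p * q < 1) (hpr : p ≤ r) (hqr : q ≤ r) : ∃ C : ℝ, 0 ≤ C ∧ ∀ (n K : ℕ) (S : Finset ℕ),
    ∑ m ∈ S, ∑ a ∈ Finset.range K, ∑ b ∈ Finset.range K,
      (if Adm n a b ∧ (b ≤ m + 10 ∧ m ≤ b + 10) then p ^ a * q ^ b else 0) ≤ C * r ^ n := by
  obtain ⟨C, hC, h⟩ := adm_sum hp hq hp1 hq1 hpq hpr hqr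
  refine ⟨21 * C, by positivity, fun n K S => ?_⟩
  rw [Finset.sum_comm]
  have : ∀ a b : ℕ, ∑ m ∈ S, (if Adm n a b ∧ (b ≤ m + 10 ∧ m ≤ b + 10) then p ^ a * q ^ b else 0)
      ≤ 21 * (if Adm n a b then p ^ a * q ^ b else 0) := by
    intro a b
    by_cases hA : Adm n a b
    · simp only [hA, true_and, if_true]
      rw [← Finset.sum_filter, Finset.sum_const, nsmul_eq_mul]
      refine mul_le_mul_of_nonneg_right ?_ (by positivity)
      have : S.filter (fun m => b ≤ m + 10 ∧ m ≤ b + 10) ⊆ Finset.Icc (b - 10) (b + 10) := by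
        intro a ha
        obtain ⟨_, h2, h3⟩ := Finset.mem_filter.1 ha
        rw [Finset.mem_Icc]; omega
      have := Finset.card_le_card this
      rw [Nat.card_Icc] at this
      have h21 : (S.filter (fun m => b ≤ m + 10 ∧ m ≤ b + 10)).card ≤ 21 := by omega
      exact_mod_cast h21
    · simp [hA]
  calc _ ≤ ∑ a ∈ Finset.range K, ∑ b ∈ Finset.range K,
        21 * (if Adm n a b then p ^ a * q ^ b else 0) := by
        refine Finset.sum_le_sum fun a _ => ?_
        rw [Finset.sum_comm]
        exact Finset.sum_le_sum fun b _ => this a b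
    _ = 21 * ∑ a ∈ Finset.range K, ∑ b ∈ Finset.range K,
        (if Adm n a b then p ^ a * q ^ b else 0) := by simp_rw [Finset.mul_sum]
    _ ≤ 21 * (C * r ^ n) := by linarith [h n K]
    _ = _ := by ring

lemma LPuv_sum {ρ : ℝ → ℝ} (hρ : IsLPCutoff ρ) (j k : ℕ) {ι : Type*} (s : Finset ι)
    {H : ι → ℝ × ℝ → ℝ} (hH : ∀ i, BC (H i)) (p : ℝ × ℝ) :
    LPu ρ j (LPv ρ k (fun y => ∑ i ∈ s, H i y)) p = ∑ i ∈ s, LPu ρ j (LPv ρ k (H i)) p := by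
  rw [LPv_sum hρ k s hH, LPu_sum hρ j s fun i => LPv_BC hρ k (hH i)]

lemma DClose_near {b m : ℕ} (h : DClose b m) : b ≤ m + 10 ∧ m ≤ b + 10 := by
  obtain ⟨h1, h2⟩ := h
  rw [div_lt_iff₀ (by positivity), ← pow_add] at h1
  rw [← pow_add] at h2
  have h1 := (pow_lt_pow_iff_right₀ (by norm_num : (1 : ℝ) < 2)).1 h1
  have h2 := (pow_lt_pow_iff_right₀ (by norm_num : (1 : ℝ) < 2)).1 h2
  omega

lemma core {ρ : ℝ → ℝ} (hρ : IsLPCutoff ρ) {p₁ q₁ r₁ p₂ q₂ r₂ : ℝ}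
    (hp₁ : 0 < p₁) (hq₁ : 0 < q₁) (hne_p₁ : p₁ ≠ 1) (hne_q₁ : q₁ ≠ 1) (hpq₁ : p₁ * q₁ < 1)
    (hpr₁ : p₁ ≤ r₁) (hqr₁ : q₁ ≤ r₁)
    (hp₂ : 0 < p₂) (hq₂ : 0 < q₂) (hne_p₂ : p₂ ≠ 1) (hne_q₂ : q₂ ≠ 1) (hpq₂ : p₂ * q₂ < 1)
    (hpr₂ : p₂ ≤ r₂) (hqr₂ : q₂ ≤ r₂) :
    ∃ C : ℝ, 0 ≤ C ∧ ∀ F G : ℕ → ℝ × ℝ → ℝ, (∀ m, BC (F m)) → (∀ m, BC (G m)) →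
      (∀ m n : ℕ, ¬ DClose n m → ∀ p, LPu ρ n (G m) p = 0) →
      ∀ A B : ℝ, 0 ≤ A → 0 ≤ B →
      (∀ m k₁ k₂ p, |LPu ρ k₁ (LPv ρ k₂ (F m)) p| ≤ A * (p₁ ^ k₁ * p₂ ^ k₂)) →
      (∀ m k₁ k₂ p, |LPu ρ k₁ (LPv ρ k₂ (G m)) p| ≤ B * (q₁ ^ k₁ * q₂ ^ k₂)) →
      ∀ (S : Finset ℕ) (n₁ n₂ : ℕ) (p : ℝ × ℝ),
        |LPu ρ n₁ (LPv ρ n₂ (fun p => ∑ m ∈ S, F m p * G m p)) p| ≤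
          C * A * B * (r₁ ^ n₁ * r₂ ^ n₂) := by
  obtain ⟨C₁, hC₁, h₁⟩ := adm_sum_family hp₁ hq₁ hne_p₁ hne_q₁ hpq₁ hpr₁ hqr₁
  obtain ⟨C₂, hC₂, h₂⟩ := adm_sum hp₂ hq₂ hne_p₂ hne_q₂ hpq₂ hpr₂ hqr₂
  have hL := LL_nonneg ρ
  have hr₁ : 0 < r₁ := hp₁.trans_le hpr₁
  have hr₂ : 0 < r₂ := hp₂.trans_le hpr₂
  have hpi : 0 < (2 * π) * (2 * π) := by positivity
  refine ⟨((2 * π) * (2 * π))⁻¹ * (LL ρ * LL ρ * C₁ * C₂), by positivity, ?_⟩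
  intro F G hF hG hsupp A B hA hB hFA hGB S n₁ n₂ p
  -- block estimate
  have blk : ∀ m a₁ a₂ b₁ b₂,
      |LPu ρ n₁ (LPv ρ n₂ (fun p => LPu ρ a₁ (LPv ρ a₂ (F m)) p * LPu ρ b₁ (LPv ρ b₂ (G m)) p)) p|
      ≤ (LL ρ * LL ρ * A * B) *
        ((if Adm n₁ a₁ b₁ ∧ (b₁ ≤ m + 10 ∧ m ≤ b₁ + 10) then p₁ ^ a₁ * q₁ ^ b₁ else 0) *
        (if Adm n₂ a₂ b₂ then p₂ ^ a₂ * q₂ ^ b₂ else 0)) := by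
    intro m a₁ a₂ b₁ b₂
    have hnn : 0 ≤ (LL ρ * LL ρ * A * B) *
        ((if Adm n₁ a₁ b₁ ∧ (b₁ ≤ m + 10 ∧ m ≤ b₁ + 10) then p₁ ^ a₁ * q₁ ^ b₁ else 0) *
        (if Adm n₂ a₂ b₂ then p₂ ^ a₂ * q₂ ^ b₂ else 0)) := by positivity
    by_cases hadm : Adm n₁ a₁ b₁ ∧ Adm n₂ a₂ b₂
    · by_cases hn : b₁ ≤ m + 10 ∧ m ≤ b₁ + 10
      · rw [if_pos ⟨hadm.1, hn⟩, if_pos hadm.2]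
        have hb : ∀ p, |LPu ρ a₁ (LPv ρ a₂ (F m)) p * LPu ρ b₁ (LPv ρ b₂ (G m)) p| ≤
            (A * (p₁ ^ a₁ * p₂ ^ a₂)) * (B * (q₁ ^ b₁ * q₂ ^ b₂)) := by
          intro p
          rw [abs_mul]
          exact mul_le_mul (hFA m a₁ a₂ p) (hGB m b₁ b₂ p) (abs_nonneg _) (by positivity)
        refine (LPu_bound hρ n₁ (LPv_bound hρ n₂ hb) p).trans (le_of_eq ?_)
        ring
      · have hz : ∀ p, LPu ρ b₁ (LPv ρ b₂ (G m)) p = 0 := by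
          intro p
          rw [LP_comm hρ _ _ (hG m)]
          exact LPv_zero ρ b₂ _ (hsupp m b₁ fun hc => hn (DClose_near hc)) p
        rw [LPu_zero ρ n₁ _ (LPv_zero ρ n₂ _ fun p => by rw [hz, mul_zero]), abs_zero]
        exact hnn
    · rw [block_zero hρ (hF m) (hG m) hadm, abs_zero]
      exact hnn
  -- bound for truncations
  have hK : ∀ K, |LPu ρ n₁ (LPv ρ n₂ (fun p => ∑ m ∈ S, FK ρ K (F m) p * FK ρ K (G m) p)) p|
      ≤ (LL ρ * LL ρ * A * B) * ((C₁ * r₁ ^ n₁) * (C₂ * r₂ ^ n₂)) := by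
    intro K
    set R := Finset.range (K + 1) with hR
    have bF : ∀ m a₁ a₂, BC (LPu ρ a₁ (LPv ρ a₂ (F m))) := fun m a₁ a₂ =>
      LPu_BC hρ _ (LPv_BC hρ _ (hF m))
    have bG : ∀ m a₁ a₂, BC (LPu ρ a₁ (LPv ρ a₂ (G m))) := fun m a₁ a₂ =>
      LPu_BC hρ _ (LPv_BC hρ _ (hG m))
    have e1 : (fun p => ∑ m ∈ S, FK ρ K (F m) p * FK ρ K (G m) p) = fun p =>
        ∑ m ∈ S, ∑ a₁ ∈ R, ∑ b₁ ∈ R, ∑ a₂ ∈ R, ∑ b₂ ∈ R,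
          LPu ρ a₁ (LPv ρ a₂ (F m)) p * LPu ρ b₁ (LPv ρ b₂ (G m)) p := by
      ext p
      simp only [FK, Finset.sum_mul_sum]
      rfl
    have bb : ∀ m a₁ b₁ a₂ b₂, BC (fun p =>
          LPu ρ a₁ (LPv ρ a₂ (F m)) p * LPu ρ b₁ (LPv ρ b₂ (G m)) p) :=
      fun m a₁ b₁ a₂ b₂ => (bF _ _ _).mul (bG _ _ _)
    rw [e1, LPuv_sum hρ n₁ n₂ S fun m => BC.sum fun a₁ => BC.sum fun b₁ => BC.sum fun a₂ =>
      BC.sum fun b₂ => bb m a₁ b₁ a₂ b₂]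
    have e2 : ∀ m, LPu ρ n₁ (LPv ρ n₂ (fun p => ∑ a₁ ∈ R, ∑ b₁ ∈ R, ∑ a₂ ∈ R, ∑ b₂ ∈ R,
          LPu ρ a₁ (LPv ρ a₂ (F m)) p * LPu ρ b₁ (LPv ρ b₂ (G m)) p)) p =
        ∑ a₁ ∈ R, ∑ b₁ ∈ R, ∑ a₂ ∈ R, ∑ b₂ ∈ R, LPu ρ n₁ (LPv ρ n₂ (fun p =>
          LPu ρ a₁ (LPv ρ a₂ (F m)) p * LPu ρ b₁ (LPv ρ b₂ (G m)) p)) p := by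
      intro m
      rw [LPuv_sum hρ n₁ n₂ R fun a₁ => BC.sum fun b₁ => BC.sum fun a₂ =>
        BC.sum fun b₂ => bb m a₁ b₁ a₂ b₂]
      refine Finset.sum_congr rfl fun a₁ _ => ?_
      rw [LPuv_sum hρ n₁ n₂ R fun b₁ => BC.sum fun a₂ => BC.sum fun b₂ => bb m a₁ b₁ a₂ b₂]
      refine Finset.sum_congr rfl fun b₁ _ => ?_
      rw [LPuv_sum hρ n₁ n₂ R fun a₂ => BC.sum fun b₂ => bb m a₁ b₁ a₂ b₂]
      refine Finset.sum_congr rfl fun a₂ _ => ?_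
      rw [LPuv_sum hρ n₁ n₂ R fun b₂ => bb m a₁ b₁ a₂ b₂]
    simp_rw [e2]
    have sb : ∀ {ι : Type} (s : Finset ι) (f g : ι → ℝ), (∀ i, |f i| ≤ g i) →
        |∑ i ∈ s, f i| ≤ ∑ i ∈ s, g i := fun s f g h =>
      (Finset.abs_sum_le_sum_abs _ _).trans (Finset.sum_le_sum fun i _ => h i)
    refine (sb _ _ _ fun m => sb _ _ _ fun a₁ => sb _ _ _ fun b₁ => sb _ _ _ fun a₂ =>
      sb _ _ _ fun b₂ => blk m a₁ a₂ b₁ b₂).trans ?_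
    simp_rw [← Finset.mul_sum, ← Finset.sum_mul]
    refine mul_le_mul_of_nonneg_left ?_ (by positivity)
    exact mul_le_mul (h₁ n₁ (K + 1) S) (h₂ n₂ (K + 1))
      (Finset.sum_nonneg fun _ _ => Finset.sum_nonneg fun _ _ => by positivity) (by positivity)
  -- limit
  have hlim : Filter.Tendsto (fun K => LPu ρ n₁ (LPv ρ n₂
      (fun p => ∑ m ∈ S, FK ρ K (F m) p * FK ρ K (G m) p)) p) Filter.atTop
      (nhds (LPu ρ n₁ (LPv ρ n₂
      (fun p => ∑ m ∈ S, (2 * π * F m p) * (2 * π * G m p))) p)) := by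
    choose CF hCF0 hCF using fun m => FK_bound hρ (hF m)
    choose CG hCG0 hCG using fun m => FK_bound hρ (hG m)
    refine LPuv_tendsto hρ n₁ n₂ (C := ∑ m ∈ S, CF m * CG m)
      (fun K => BC.sum fun m => (FK_BC hρ K (hF m)).mul (FK_BC hρ K (hG m))) ?_ ?_ p
    · intro K x
      refine (Finset.abs_sum_le_sum_abs _ _).trans (Finset.sum_le_sum fun m _ => ?_)
      rw [abs_mul]
      exact mul_le_mul (hCF m K x) (hCG m K x) (abs_nonneg _) (hCF0 m)
    · intro x
      exact tendsto_finsetSum _ fun m _ => (FK_tendsto hρ (hF m) x).mul (FK_tendsto hρ (hG m) x)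
  have hle := le_of_tendsto hlim.abs (Filter.Eventually.of_forall hK)
  have e3 : LPu ρ n₁ (LPv ρ n₂ (fun p => ∑ m ∈ S, (2 * π * F m p) * (2 * π * G m p))) p =
      ((2 * π) * (2 * π)) * LPu ρ n₁ (LPv ρ n₂ (fun p => ∑ m ∈ S, F m p * G m p)) p := by
    have : ∀ p, ∑ m ∈ S, (2 * π * F m p) * (2 * π * G m p) =
        ((2 * π) * (2 * π)) * ∑ m ∈ S, F m p * G m p := by
      intro p
      rw [Finset.mul_sum]
      exact Finset.sum_congr rfl fun m _ => by ring
    simp only [this, LPu, LPv]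
    simp_rw [mul_left_comm _ (2 * π * (2 * π)), integral_const_mul]
    simp_rw [mul_left_comm _ (2 * π * (2 * π)), integral_const_mul]
  rw [e3, abs_mul, abs_of_pos hpi] at hle
  have := (le_inv_mul_iff₀ hpi).2 hle
  refine this.trans (le_of_eq ?_)
  ring

lemma two_pow_rpow_mul (α : ℝ) (k : ℕ) : ((2 : ℝ) ^ k) ^ α * ((2 : ℝ) ^ (-α)) ^ k = 1 := by
  rw [← Real.rpow_natCast, ← Real.rpow_natCast, ← Real.rpow_mul (by norm_num),
    ← Real.rpow_mul (by norm_num), ← Real.rpow_add (by norm_num)]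
  have : (k : ℝ) * α + -α * k = 0 := by ring
  rw [this, Real.rpow_zero]

lemma block_of_hNorm2 {ρ : ℝ → ℝ} {α₁ α₂ A : ℝ} {F : ℝ × ℝ → ℝ} (hA : 0 ≤ A)
    (h : hNorm2 ρ α₁ α₂ F ≤ ENNReal.ofReal A) (k₁ k₂ : ℕ) (p : ℝ × ℝ) :
    |LPu ρ k₁ (LPv ρ k₂ F) p| ≤ A * (((2 : ℝ) ^ (-α₁)) ^ k₁ * ((2 : ℝ) ^ (-α₂)) ^ k₂) := by
  have h1 : ENNReal.ofReal (((2 : ℝ) ^ k₁) ^ α₁ * ((2 : ℝ) ^ k₂) ^ α₂) *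
      ENNReal.ofReal |LPu ρ k₁ (LPv ρ k₂ F) p| ≤ ENNReal.ofReal A := by
    refine le_trans ?_ h
    refine le_trans ?_ (le_iSup₂ (f := fun k₁ k₂ : ℕ =>
      ENNReal.ofReal (((2 : ℝ) ^ k₁) ^ α₁ * ((2 : ℝ) ^ k₂) ^ α₂) *
      ⨆ p : ℝ × ℝ, ENNReal.ofReal |LPu ρ k₁ (LPv ρ k₂ F) p|) k₁ k₂)
    gcongr
    exact le_iSup (fun p => ENNReal.ofReal |LPu ρ k₁ (LPv ρ k₂ F) p|) p
  rw [← ENNReal.ofReal_mul (by positivity), ENNReal.ofReal_le_ofReal_iff hA] at h1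
  have e1 := two_pow_rpow_mul α₁ k₁
  have e2 := two_pow_rpow_mul α₂ k₂
  have := mul_le_mul_of_nonneg_right h1
    (by positivity : 0 ≤ (((2 : ℝ) ^ (-α₁)) ^ k₁ * ((2 : ℝ) ^ (-α₂)) ^ k₂))
  refine le_trans (le_of_eq ?_) this
  calc _ = (((2 : ℝ) ^ k₁) ^ α₁ * ((2 : ℝ) ^ (-α₁)) ^ k₁) *
        (((2 : ℝ) ^ k₂) ^ α₂ * ((2 : ℝ) ^ (-α₂)) ^ k₂) * |LPu ρ k₁ (LPv ρ k₂ F) p| := by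
        rw [e1, e2]; ring
    _ = _ := by ring

lemma hNorm2_of_block {ρ : ℝ → ℝ} {α₁ α₂ A : ℝ} {F : ℝ × ℝ → ℝ}
    (h : ∀ k₁ k₂ p, |LPu ρ k₁ (LPv ρ k₂ F) p| ≤
      A * (((2 : ℝ) ^ (-α₁)) ^ k₁ * ((2 : ℝ) ^ (-α₂)) ^ k₂)) :
    hNorm2 ρ α₁ α₂ F ≤ ENNReal.ofReal A := by
  refine iSup₂_le fun k₁ k₂ => ?_
  rw [ENNReal.mul_iSup]
  refine iSup_le fun p => ?_
  rw [← ENNReal.ofReal_mul (by positivity)]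
  refine ENNReal.ofReal_le_ofReal ?_
  have e1 := two_pow_rpow_mul α₁ k₁
  have e2 := two_pow_rpow_mul α₂ k₂
  refine (mul_le_mul_of_nonneg_left (h k₁ k₂ p) (by positivity)).trans (le_of_eq ?_)
  calc _ = A * (((2 : ℝ) ^ k₁) ^ α₁ * ((2 : ℝ) ^ (-α₁)) ^ k₁) *
        (((2 : ℝ) ^ k₂) ^ α₂ * ((2 : ℝ) ^ (-α₂)) ^ k₂) := by ring
    _ = A := by rw [e1, e2]; ring

lemma zero_of_hNorm2 {ρ : ℝ → ℝ} (hρ : IsLPCutoff ρ) {α₁ α₂ : ℝ} {F : ℝ × ℝ → ℝ} (hF : BC F)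
    (h : hNorm2 ρ α₁ α₂ F = 0) (p : ℝ × ℝ) : F p = 0 := by
  have hb := block_of_hNorm2 (A := 0) le_rfl (by rw [h]; exact zero_le)
  have h0 : ∀ K, FK ρ K F p = 0 := by
    intro K
    refine Finset.sum_eq_zero fun a _ => Finset.sum_eq_zero fun b _ => ?_
    have := hb a b p
    rw [zero_mul] at this
    exact abs_nonpos_iff.1 this
  have ht := FK_tendsto hρ hF p
  simp only [h0] at ht
  have := tendsto_nhds_unique ht tendsto_const_nhds
  have hp : (2 * π) ≠ 0 := by positivity
  exact (mul_eq_zero.1 this).resolve_left hp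

lemma hNorm2_zero {ρ : ℝ → ℝ} {α₁ α₂ : ℝ} {F : ℝ × ℝ → ℝ} (h : ∀ p, F p = 0) :
    hNorm2 ρ α₁ α₂ F = 0 := by
  have := hNorm2_of_block (ρ := ρ) (α₁ := α₁) (α₂ := α₂) (A := 0) (F := F) (fun k₁ k₂ p => by
    rw [LPu_zero ρ k₁ _ (LPv_zero ρ k₂ _ h)]; simp)
  simpa using this

/-- **Corollary 2.8: bilinear estimate for families of functions.**
Under the conditions of the general bilinear estimate, if `(F_M)` and `(G_M)` are families of
`C_b^∞` functions indexed by dyadic scales such that `G_M` is supported on `u`-frequencies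
`∼ M`, then `‖Σ_M F_M G_M‖ ≲ (sup_M ‖F_M‖)(sup_M ‖G_M‖)`, with a supremum (not a sum) over `M`
on the right-hand side. -/
theorem bilinear_estimate_families
    (ρ : ℝ → ℝ) (hρ : IsLPCutoff ρ)
    (α₁ α₂ β₁ β₂ γ₁ γ₂ : ℝ)
    (hα₁ : α₁ ≠ 0) (hα₂ : α₂ ≠ 0) (hβ₁ : β₁ ≠ 0) (hβ₂ : β₂ ≠ 0)
    (hγ₁ : γ₁ ≤ min α₁ β₁) (hγ₂ : γ₂ ≤ min α₂ β₂)
    (hab₁ : 0 < α₁ + β₁) (hab₂ : 0 < α₂ + β₂) :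
    ∃ C : ℝ≥0∞, C ≠ ∞ ∧ ∀ F G : ℕ → ℝ × ℝ → ℝ,
      (∀ m, CbSmooth (F m)) → (∀ m, CbSmooth (G m)) →
      (∀ m n : ℕ, ¬ DClose n m → ∀ p, LPu ρ n (G m) p = 0) →
      ∀ S : Finset ℕ,
        hNorm2 ρ γ₁ γ₂ (fun p => ∑ m ∈ S, F m p * G m p) ≤
          C * (⨆ m : ℕ, hNorm2 ρ α₁ α₂ (F m)) * (⨆ m : ℕ, hNorm2 ρ β₁ β₂ (G m)) := by
  have pos : ∀ x : ℝ, 0 < (2 : ℝ) ^ (-x) := fun x => by positivity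
  have ne1 : ∀ x : ℝ, x ≠ 0 → (2 : ℝ) ^ (-x) ≠ 1 := by
    intro x hx h
    have h2 := congrArg Real.log h
    rw [Real.log_rpow (by norm_num), Real.log_one] at h2
    have hl : Real.log 2 ≠ 0 := (Real.log_pos (by norm_num)).ne'
    exact hx (neg_eq_zero.1 ((mul_eq_zero.1 h2).resolve_right hl))
  have mul1 : ∀ x y : ℝ, 0 < x + y → (2 : ℝ) ^ (-x) * (2 : ℝ) ^ (-y) < 1 := by
    intro x y h
    rw [← Real.rpow_add (by norm_num)]
    exact Real.rpow_lt_one_of_one_lt_of_neg (by norm_num) (by linarith)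
  have mono : ∀ x y : ℝ, y ≤ x → (2 : ℝ) ^ (-x) ≤ (2 : ℝ) ^ (-y) := by
    intro x y h
    exact Real.rpow_le_rpow_of_exponent_le (by norm_num) (by linarith)
  obtain ⟨g1, g2⟩ := le_min_iff.1 hγ₁
  obtain ⟨g3, g4⟩ := le_min_iff.1 hγ₂
  obtain ⟨C, hC, h⟩ := core hρ (pos α₁) (pos β₁) (ne1 _ hα₁) (ne1 _ hβ₁) (mul1 _ _ hab₁)
    (mono _ _ g1) (mono _ _ g2) (pos α₂) (pos β₂) (ne1 _ hα₂) (ne1 _ hβ₂) (mul1 _ _ hab₂)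
    (mono _ _ g3) (mono _ _ g4)
  refine ⟨ENNReal.ofReal C + 1, by simp, ?_⟩
  intro F G hF hG hsupp S
  have hF' := fun m => (hF m).bc
  have hG' := fun m => (hG m).bc
  by_cases hA0 : (⨆ m : ℕ, hNorm2 ρ α₁ α₂ (F m)) = 0
  · rw [hNorm2_zero]
    · exact zero_le
    · intro p
      refine Finset.sum_eq_zero fun m _ => ?_
      rw [zero_of_hNorm2 hρ (hF' m) (ENNReal.iSup_eq_zero.1 hA0 m), zero_mul]
  by_cases hB0 : (⨆ m : ℕ, hNorm2 ρ β₁ β₂ (G m)) = 0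
  · rw [hNorm2_zero]
    · exact zero_le
    · intro p
      refine Finset.sum_eq_zero fun m _ => ?_
      rw [zero_of_hNorm2 hρ (hG' m) (ENNReal.iSup_eq_zero.1 hB0 m), mul_zero]
  have hC1 : ENNReal.ofReal C + 1 ≠ 0 := by simp
  by_cases hAt : (⨆ m : ℕ, hNorm2 ρ α₁ α₂ (F m)) = ∞
  · rw [hAt, ENNReal.mul_top hC1, ENNReal.top_mul hB0]
    exact le_top
  by_cases hBt : (⨆ m : ℕ, hNorm2 ρ β₁ β₂ (G m)) = ∞
  · rw [hBt, ENNReal.mul_top (mul_ne_zero hC1 hA0)]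
    exact le_top
  set A := (⨆ m : ℕ, hNorm2 ρ α₁ α₂ (F m)).toReal with hAdef
  set B := (⨆ m : ℕ, hNorm2 ρ β₁ β₂ (G m)).toReal with hBdef
  have hA : 0 ≤ A := ENNReal.toReal_nonneg
  have hB : 0 ≤ B := ENNReal.toReal_nonneg
  have eA : (⨆ m : ℕ, hNorm2 ρ α₁ α₂ (F m)) = ENNReal.ofReal A := (ENNReal.ofReal_toReal hAt).symm
  have eB : (⨆ m : ℕ, hNorm2 ρ β₁ β₂ (G m)) = ENNReal.ofReal B := (ENNReal.ofReal_toReal hBt).symm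
  have key := h F G hF' hG' hsupp A B hA hB
    (fun m => block_of_hNorm2 hA ((le_iSup (fun m => hNorm2 ρ α₁ α₂ (F m)) m).trans eA.le))
    (fun m => block_of_hNorm2 hB ((le_iSup (fun m => hNorm2 ρ β₁ β₂ (G m)) m).trans eB.le)) S
  refine (hNorm2_of_block key).trans ?_
  rw [eA, eB, ENNReal.ofReal_mul (by positivity), ENNReal.ofReal_mul hC]
  gcongr
  exact le_self_add
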